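/- arXiv:1901.08511 — 2 statements merged into one kernel-verified Lean document; each statement's English description precedes it below -/
import Mathlib

section
/- Let (H, ⟪·,·⟫) be a real inner product space, let 0 < μ ≤ L, and let F : H → H be L-Lipschitz and μ-strongly monotone with F(z*) = 0 for some z* ∈ H. Set η = 1/(4L). Let (z_k)_{k≥0} satisfy z_1 = z_0 − ηF(z_0) and z_{k+1} = z_k − 2ηF(z_k) + ηF(z_{k−1}) for all k ≥ 1. Then for every k ≥ 1, ‖z_k − z_{k−1}‖² ≤ 16 (1 − μ/(4L))^k ‖z_0 − z*‖². -/
open RealInnerProductSpace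

section Lyapunov

variable {H : Type*} [NormedAddCommGroup H] [InnerProductSpace ℝ H]

/-- The parallelogram law bounds `‖v + w‖²` by `2‖v‖² + 2‖w‖²`. -/
lemma norm_add_sq_le_two_mul (v w : H) : ‖v + w‖ ^ 2 ≤ 2 * ‖v‖ ^ 2 + 2 * ‖w‖ ^ 2 := by
  have h := parallelogram_law_with_norm ℝ v w
  nlinarith [mul_self_nonneg ‖v - w‖]

lemma norm_two_smul_sub_sq_le (a b : H) :
    ‖(2 : ℝ) • b - a‖ ^ 2 ≤ 2 * ‖b‖ ^ 2 + 2 * ‖b - a‖ ^ 2 := by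
  have h := norm_add_sq_le_two_mul b (b - a)
  rwa [show b + (b - a) = (2 : ℝ) • b - a by module] at h

/-- One-step decrease of the OGDA Lyapunov function: `x` is the error of the current iterate and
`a`, `b`, `c` are three consecutive scaled operator values, `c` being the one at the current
iterate. -/
lemma ogda_lyapunov_step {m : ℝ} (hm : 0 ≤ m) (hm' : m ≤ 1 / 4) (x a b c : H)
    (hmono : m * ‖x‖ ^ 2 ≤ ⟪c, x⟫) (hLip : ‖c - b‖ ^ 2 ≤ 1 / 16 * ‖(2 : ℝ) • b - a‖ ^ 2) :
    ‖x - c + b‖ ^ 2 + ‖c - b‖ ^ 2 + 1 / 4 * ‖b‖ ^ 2 ≤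
      (1 - m) * (‖x + b‖ ^ 2 + ‖b - a‖ ^ 2) := by
  have hexp : ‖x - c + b‖ ^ 2 = ‖x + b‖ ^ 2 - 2 * ⟪c, x⟫ + ‖c - b‖ ^ 2 - ‖b‖ ^ 2 := by
    simp only [← real_inner_self_eq_norm_sq, inner_add_left, inner_add_right, inner_sub_left,
      inner_sub_right, real_inner_comm x c, real_inner_comm b c, real_inner_comm b x]
    ring
  have hx := mul_le_mul_of_nonneg_left (norm_add_sq_le_two_mul x b) hm
  have hab := norm_two_smul_sub_sq_le a b
  have hb := mul_le_mul_of_nonneg_right hm' (sq_nonneg ‖b‖)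
  have hba := mul_le_mul_of_nonneg_right hm' (sq_nonneg ‖b - a‖)
  linarith [sq_nonneg ‖b - a‖]

end Lyapunov

/-- For the OGDA iteration `z_{k+1} = z_k − 2ηF(z_k) + ηF(z_{k−1})`,
initialized by a plain gradient step `z_1 = z_0 − ηF(z_0)`, applied to an `L`-Lipschitz,
`μ`-strongly monotone operator `F` with zero `z*` and stepsize `η = 1/(4L)`: for all
`k ≥ 1`, `‖z_k − z_{k−1}‖² ≤ 16 (1 − μ/(4L))^k ‖z_0 − z*‖²`. -/
theorem ogda_successive_iterates_decay (H : Type*) [NormedAddCommGroup H] [InnerProductSpace ℝ H]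
    (μ L η : ℝ) (hμ : 0 < μ) (hμL : μ ≤ L) (hη : η = 1 / (4 * L))
    (F : H → H)
    (hLip : ∀ z w : H, ‖F z - F w‖ ≤ L * ‖z - w‖)
    (hmono : ∀ z w : H, μ * ‖z - w‖ ^ 2 ≤ ⟪F z - F w, z - w⟫)
    (zs : H) (hzs : F zs = 0)
    (z : ℕ → H)
    (hinit : z 1 = z 0 - η • F (z 0))
    (hrec : ∀ k, 1 ≤ k → z (k + 1) = z k - (2 * η) • F (z k) + η • F (z (k - 1))) :
    ∀ k, 1 ≤ k → ‖z k - z (k - 1)‖ ^ 2 ≤ 16 * (1 - μ / (4 * L)) ^ k * ‖z 0 - zs‖ ^ 2 := by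
  have hL : 0 < L := hμ.trans_le hμL
  have hη0 : 0 < η := by rw [hη]; positivity
  have hηL : η * L = 1 / 4 := by rw [hη]; field_simp
  have hm : μ / (4 * L) = η * μ := by rw [hη]; ring
  have hm0 : 0 ≤ η * μ := by positivity
  have hm1 : η * μ ≤ 1 / 4 := hηL ▸ mul_le_mul_of_nonneg_left hμL hη0.le
  rw [hm]
  have hr0 : 0 ≤ 1 - η * μ := by linarith
  set g : ℕ → H := fun n => η • F (z n) with hg
  -- With truncated subtraction, the recursion at `k = 0` is the initial gradient step.
  have hstep (k : ℕ) : z (k + 1) = z k - (2 : ℝ) • g k + g (k - 1) := by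
    rcases Nat.eq_zero_or_pos k with rfl | hk
    · simp only [hg, zero_add, zero_tsub, hinit]
      module
    · simp only [hg, hrec k hk]
      module
  have hdiff (k : ℕ) : ‖z (k + 1) - z k‖ = ‖(2 : ℝ) • g k - g (k - 1)‖ := by
    rw [hstep k, ← norm_neg]
    congr 1
    abel
  have hgLip (k : ℕ) :
      ‖g (k + 1) - g k‖ ^ 2 ≤ 1 / 16 * ‖(2 : ℝ) • g k - g (k - 1)‖ ^ 2 := by
    have h : ‖g (k + 1) - g k‖ ≤ 1 / 4 * ‖(2 : ℝ) • g k - g (k - 1)‖ := by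
      rw [← hdiff k, ← hηL, mul_assoc]
      simp only [hg]
      rw [← smul_sub, norm_smul, Real.norm_of_nonneg hη0.le]
      exact mul_le_mul_of_nonneg_left (hLip _ _) hη0.le
    calc ‖g (k + 1) - g k‖ ^ 2 ≤ (1 / 4 * ‖(2 : ℝ) • g k - g (k - 1)‖) ^ 2 := by gcongr
      _ = _ := by ring
  have hgmono (k : ℕ) : η * μ * ‖z k - zs‖ ^ 2 ≤ ⟪g k, z k - zs⟫ := by
    have h := mul_le_mul_of_nonneg_left (hmono (z k) zs) hη0.le
    rw [hzs, sub_zero] at h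
    simpa only [hg, real_inner_smul_left, mul_assoc] using h
  set V : ℕ → ℝ := fun n => ‖z (n + 1) - zs + g n‖ ^ 2 + ‖g n - g (n - 1)‖ ^ 2 with hV
  have hdecr (n : ℕ) : V (n + 1) + 1 / 4 * ‖g n‖ ^ 2 ≤ (1 - η * μ) * V n := by
    have h := ogda_lyapunov_step hm0 hm1 (z (n + 1) - zs) (g (n - 1)) (g n) (g (n + 1))
      (hgmono (n + 1)) (hgLip n)
    have hx : z (n + 1 + 1) - zs + g (n + 1) = z (n + 1) - zs - g (n + 1) + g n := by
      rw [hstep (n + 1), Nat.add_sub_cancel]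
      module
    simpa only [hV, hx, Nat.add_sub_cancel] using h
  have hVbound (n : ℕ) : V n ≤ (1 - η * μ) ^ n * ‖z 0 - zs‖ ^ 2 := by
    induction n with
    | zero =>
      have hx : z (0 + 1) - zs + g 0 = z 0 - zs := by
        rw [hstep 0, zero_tsub]
        module
      simp [hV, hx]
    | succ n ih =>
      calc V (n + 1) ≤ (1 - η * μ) * V n := by linarith [hdecr n, sq_nonneg ‖g n‖]
        _ ≤ (1 - η * μ) * ((1 - η * μ) ^ n * ‖z 0 - zs‖ ^ 2) := by gcongr
        _ = _ := by ring
  intro k hk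
  obtain ⟨n, rfl⟩ := Nat.exists_eq_add_of_le' hk
  rw [Nat.add_sub_cancel, hdiff n]
  have hsplit := norm_two_smul_sub_sq_le (g (n - 1)) (g n)
  have hgn : ‖g n‖ ^ 2 ≤ 4 * ((1 - η * μ) * V n) := by
    have : 0 ≤ V (n + 1) := by positivity
    linarith [hdecr n]
  have hen : ‖g n - g (n - 1)‖ ^ 2 ≤ V n := le_add_of_nonneg_left (sq_nonneg _)
  have hV0 : 0 ≤ V n := by positivity
  calc ‖(2 : ℝ) • g n - g (n - 1)‖ ^ 2 ≤ 16 * ((1 - η * μ) * V n) := by nlinarith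
    _ ≤ 16 * ((1 - η * μ) * ((1 - η * μ) ^ n * ‖z 0 - zs‖ ^ 2)) := by
      gcongr
      exact hVbound n
    _ = _ := by ring
end

section
/- Let B be a real d×d matrix and let μ, Λ > 0 satisfy μ‖v‖² ≤ ‖Bv‖² ≤ Λ‖v‖² and μ‖v‖² ≤ ‖Bᵀv‖² ≤ Λ‖v‖² for all v ∈ ℝ^d. Set η = 1/(2√(2Λ)). Given x, y ∈ ℝ^d, define the extra-gradient step x⁺ = x − ηB(y + ηBᵀx) and y⁺ = y + ηBᵀ(x − ηBy). Then ‖x⁺‖² + ‖y⁺‖² ≤ (1 − μ/(20Λ)) (‖x‖² + ‖y‖²). -/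
open Matrix

open scoped InnerProductSpace in
/-- The exact change of the squared distance to the saddle point `(0,0)` in one extra-gradient
step for `⟪x, S y⟫`, where `T` is the adjoint of `S`. -/
theorem extragradient_bilinear_norm_sq {E F : Type*} [NormedAddCommGroup E]
    [InnerProductSpace ℝ E] [NormedAddCommGroup F] [InnerProductSpace ℝ F]
    (S : F →ₗ[ℝ] E) (T : E →ₗ[ℝ] F) (hST : ∀ a b, ⟪a, T b⟫_ℝ = ⟪S a, b⟫_ℝ) (η : ℝ)
    (x : E) (y : F) :
    ‖x - η • S (y + η • T x)‖ ^ 2 + ‖y + η • T (x - η • S y)‖ ^ 2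
      = ‖x‖ ^ 2 + ‖y‖ ^ 2 - η ^ 2 * (‖T x‖ ^ 2 + ‖S y‖ ^ 2)
        + η ^ 4 * (‖S (T x)‖ ^ 2 + ‖T (S y)‖ ^ 2) := by
  simp only [← real_inner_self_eq_norm_sq, map_add, map_sub, map_smul, inner_add_left,
    inner_add_right, inner_sub_left, inner_sub_right, real_inner_smul_left,
    real_inner_smul_right, smul_add, smul_sub]
  rw [real_inner_comm (S y) x, real_inner_comm (S (T x)) x, real_inner_comm (S (T x)) (S y),
    real_inner_comm y (T x), real_inner_comm y (T (S y)), real_inner_comm (T x) (T (S y))]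
  linear_combination 2 * η * hST y x + 2 * η ^ 2 * hST (T x) x - 2 * η ^ 2 * hST y (S y)
    - 2 * η ^ 3 * hST (T x) (S y)

open scoped InnerProductSpace in
theorem inner_toEuclideanLin_transpose {m n : Type*} [Fintype m] [DecidableEq m] [Fintype n]
    [DecidableEq n] (B : Matrix m n ℝ) (a : EuclideanSpace ℝ n) (b : EuclideanSpace ℝ m) :
    ⟪a, Matrix.toEuclideanLin Bᵀ b⟫_ℝ = ⟪Matrix.toEuclideanLin B a, b⟫_ℝ := by
  rw [← Matrix.conjTranspose_eq_transpose_of_trivial,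
    Matrix.toEuclideanLin_conjTranspose_eq_adjoint, LinearMap.adjoint_inner_right]

/-- One step of the extra-gradient method with stepsize
`η = 1/(2√(2Λ))` for the bilinear saddle point problem `min_x max_y xᵀBy`,
`x⁺ = x − ηB(y + ηBᵀx)`, `y⁺ = y + ηBᵀ(x − ηBy)`, contracts the squared distance to
the saddle point `(0,0)` by a factor `1 − μ/(20Λ)`. -/
theorem eg_bilinear_contraction (d : ℕ) (B : Matrix (Fin d) (Fin d) ℝ) (μ Λ η : ℝ)
    (hμ : 0 < μ) (hΛ : 0 < Λ)
    (hB₁ : ∀ v : EuclideanSpace ℝ (Fin d), μ * ‖v‖ ^ 2 ≤ ‖Matrix.toEuclideanLin B v‖ ^ 2)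
    (hB₂ : ∀ v : EuclideanSpace ℝ (Fin d), ‖Matrix.toEuclideanLin B v‖ ^ 2 ≤ Λ * ‖v‖ ^ 2)
    (hBt₁ : ∀ v : EuclideanSpace ℝ (Fin d), μ * ‖v‖ ^ 2 ≤ ‖Matrix.toEuclideanLin Bᵀ v‖ ^ 2)
    (hBt₂ : ∀ v : EuclideanSpace ℝ (Fin d), ‖Matrix.toEuclideanLin Bᵀ v‖ ^ 2 ≤ Λ * ‖v‖ ^ 2)
    (hη : η = 1 / (2 * Real.sqrt (2 * Λ)))
    (x xp y yp : EuclideanSpace ℝ (Fin d))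
    (hxp : xp = x - η • Matrix.toEuclideanLin B (y + η • Matrix.toEuclideanLin Bᵀ x))
    (hyp : yp = y + η • Matrix.toEuclideanLin Bᵀ (x - η • Matrix.toEuclideanLin B y)) :
    ‖xp‖ ^ 2 + ‖yp‖ ^ 2 ≤ (1 - μ / (20 * Λ)) * (‖x‖ ^ 2 + ‖y‖ ^ 2) := by
  have hη2 : η ^ 2 = 1 / (8 * Λ) := by
    rw [hη, div_pow, mul_pow, Real.sq_sqrt (by positivity)]
    ring
  have hη4 : η ^ 4 * Λ = η ^ 2 / 8 := by
    rw [show η ^ 4 = η ^ 2 * η ^ 2 by ring, hη2]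
    field_simp
  have hrate : μ / (20 * Λ) = 2 / 5 * (η ^ 2 * μ) := by
    rw [hη2]
    field_simp
    norm_num
  rw [hxp, hyp, extragradient_bilinear_norm_sq _ _ (inner_toEuclideanLin_transpose B), hrate]
  have hη0 : 0 ≤ η ^ 2 := by positivity
  have hη40 : 0 ≤ η ^ 4 := by positivity
  have h₁ := mul_le_mul_of_nonneg_left (hBt₁ x) hη0
  have h₂ := mul_le_mul_of_nonneg_left (hB₁ y) hη0
  have h₃ := mul_le_mul_of_nonneg_left (hB₂ (Matrix.toEuclideanLin Bᵀ x)) hη40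
  have h₄ := mul_le_mul_of_nonneg_left (hBt₂ (Matrix.toEuclideanLin B y)) hη40
  rw [← mul_assoc, hη4] at h₃ h₄
  have h₅ : 0 ≤ η ^ 2 * ‖Matrix.toEuclideanLin Bᵀ x‖ ^ 2 := by positivity
  have h₆ : 0 ≤ η ^ 2 * ‖Matrix.toEuclideanLin B y‖ ^ 2 := by positivity
  linarith
end
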